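/- Let I be a finite set of data vectors of arity k and dimension d, partitioned into the set I₁ of data vectors reversible in Perm(I) and the set I₂ of data vectors nonreversible in Perm(I). Suppose a data vector v can be expressed as a finite sum v = Σ_{y ∈ Perm(I₁)} a_y·y + Σ_{w ∈ Perm(I₂)} b_w·w with a_y, b_w ∈ ℕ (only finitely many nonzero). Then Σ_{w ∈ Perm(I₂)} b_w ≤ |P(I₂)| · (‖P(I)‖_{1,∞} + ‖P(v)‖_∞ + 2)^{d + |I|}. -/

import Mathlib

/-- A data vector of dimension `d`: a finitely supported function from finite
subsets of the data domain `ℕ` (the `k`-element ones being relevant) to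
vectors in `ℤ^d`. -/
abbrev HG (d : ℕ) := (Finset ℕ) →₀ (Fin d → ℤ)

/-- `v` is a data vector of arity `k`: it is supported on `k`-element sets. -/
def IsHG (k : ℕ) {d : ℕ} (v : HG d) : Prop := ∀ e ∈ v.support, e.card = k

/-- The action of a data permutation `π : ℕ ≃ ℕ` on a data vector:
`(v ∘ π)({α₁, …, α_k}) = v({π α₁, …, π α_k})`. -/
def permDV {d : ℕ} (π : ℕ ≃ ℕ) (v : HG d) : HG d :=
  Finsupp.equivMapDomain π.symm.finsetCongr v

/-- `Perm(I)`: the closure of the set `I` of data vectors under data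
permutations. -/
def Perm {d : ℕ} (I : Set (HG d)) : Set (HG d) :=
  {w | ∃ v ∈ I, ∃ π : ℕ ≃ ℕ, w = permDV π v}

/-- `Σ_ℕ(U)` for a set `U` of data vectors: all finite sums of members of `U`
with nonnegative-integer coefficients. -/
def NsumDV {d : ℕ} (U : Set (HG d)) : Set (HG d) :=
  {x | ∃ (l : ℕ) (c : Fin l → ℕ) (u : Fin l → HG d),
      (∀ i, u i ∈ U) ∧ x = ∑ i, c i • u i}

/-- `Σ_ℕ(U)` for a set `U` of vectors in `ℤ^d`: all finite sums of members of
`U` with nonnegative-integer coefficients. -/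
def NsumV {d : ℕ} (U : Set (Fin d → ℤ)) : Set (Fin d → ℤ) :=
  {x | ∃ (l : ℕ) (c : Fin l → ℕ) (u : Fin l → (Fin d → ℤ)),
      (∀ i, u i ∈ U) ∧ x = ∑ i, c i • u i}

/-- The data projection `P(v) = Σ_x v(x) ∈ ℤ^d` of a data vector `v`. -/
def proj {d : ℕ} (v : HG d) : Fin d → ℤ := ∑ e ∈ v.support, v e
/-- The infinity norm `‖u‖_∞ = max_i |u_i|` of a vector `u ∈ ℤ^d`. -/
def linf {d : ℕ} (u : Fin d → ℤ) : ℕ := Finset.univ.sup fun i => (u i).natAbs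

/-- The one-norm `‖u‖₁ = Σ_i |u_i|` of a vector `u ∈ ℤ^d`. -/
def l1 {d : ℕ} (u : Fin d → ℤ) : ℕ := ∑ i, (u i).natAbs

lemma proj_eq_degree {d : ℕ} (v : HG d) : proj v = Finsupp.degree v := rfl

lemma permDV_apply {d : ℕ} (π : ℕ ≃ ℕ) (v : HG d) (e : Finset ℕ) :
    permDV π v e = v (e.map π.toEmbedding) := by
  simp [permDV, Finsupp.equivMapDomain_apply]

lemma permDV_one {d : ℕ} (v : HG d) : permDV (1 : Equiv.Perm ℕ) v = v := by
  ext1 e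
  rw [permDV_apply]
  congr 1
  exact Finset.map_refl

lemma permDV_add {d : ℕ} (π : ℕ ≃ ℕ) (v w : HG d) :
    permDV π (v + w) = permDV π v + permDV π w := by
  ext1 e
  simp [permDV_apply]

lemma permDV_permDV {d : ℕ} (π ρ : ℕ ≃ ℕ) (v : HG d) :
    permDV π (permDV ρ v) = permDV (π.trans ρ) v := by
  ext1 e
  simp only [permDV_apply, Finset.map_map]
  rfl

lemma proj_permDV {d : ℕ} (π : ℕ ≃ ℕ) (v : HG d) : proj (permDV π v) = proj v := by
  unfold proj permDV
  rw [Finsupp.equivMapDomain_eq_mapDomain]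
  exact Finsupp.sum_mapDomain_index (h := fun _ a => a) (by simp) (by simp)

lemma closure_perm {d : ℕ} {I : Set (HG d)} (π : ℕ ≃ ℕ) {h : HG d}
    (hh : h ∈ AddSubmonoid.closure (Perm I)) :
    permDV π h ∈ AddSubmonoid.closure (Perm I) := by
  induction hh using AddSubmonoid.closure_induction with
  | mem x hx =>
    obtain ⟨v, hv, ρ, rfl⟩ := hx
    apply AddSubmonoid.subset_closure
    exact ⟨v, hv, _, permDV_permDV _ _ _⟩
  | zero =>
    have : permDV π (0 : HG d) = 0 := by
      ext1 e
      simp [permDV_apply]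
    rw [this]
    exact zero_mem _
  | add x y _ _ hx hy =>
    rw [permDV_add]
    exact add_mem hx hy

lemma closure_sub_Nsum {d : ℕ} {U : Set (HG d)} {h : HG d}
    (hh : h ∈ AddSubmonoid.closure U) : h ∈ NsumDV U := by
  obtain ⟨l, hl, rfl⟩ := AddSubmonoid.exists_list_of_mem_closure hh
  refine ⟨l.length, fun _ => 1, fun i => l.get i, fun i => hl _ (l.get_mem i), ?_⟩
  simp only [one_smul]
  rw [← List.sum_ofFn, List.ofFn_get]

lemma exists_perm_map (S e e' : Finset ℕ) (he : e ⊆ S) (he' : e' ⊆ S) (hc : e.card = e'.card) :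
    ∃ τ : Equiv.Perm {x // x ∈ S},
      e.map (Equiv.Perm.ofSubtype τ : Equiv.Perm ℕ).toEmbedding = e' := by
  have E : ∀ f : Finset ℕ, f ⊆ S → Nonempty ({x : {x // x ∈ S} // x.1 ∈ f} ≃ f) := fun f hf =>
    ⟨⟨fun x => ⟨x.1.1, x.2⟩, fun y => ⟨⟨y.1, hf y.2⟩, y.2⟩, fun x => rfl, fun y => rfl⟩⟩
  obtain ⟨E1⟩ := E e he
  obtain ⟨E2⟩ := E e' he'
  have F := (E1.trans (Finset.equivOfCardEq hc)).trans E2.symm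
  refine ⟨F.extendSubtype, ?_⟩
  apply Finset.eq_of_subset_of_card_le
  · intro x hx
    simp only [Finset.mem_map, Equiv.coe_toEmbedding] at hx
    obtain ⟨y, hy, rfl⟩ := hx
    rw [Equiv.Perm.ofSubtype_apply_of_mem _ (he hy)]
    exact F.extendSubtype_mem ⟨y, he hy⟩ hy
  · simp [hc]

lemma avg_zero {k d : ℕ} (h : HG d) (hk : IsHG k h) (hp : proj h = 0) (S : Finset ℕ)
    (hS : ∀ e ∈ h.support, e ⊆ S) :
    ∑ σ : Equiv.Perm {x // x ∈ S}, permDV (Equiv.Perm.ofSubtype σ : Equiv.Perm ℕ) h = 0 := by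
  set g := ∑ σ : Equiv.Perm {x // x ∈ S}, permDV (Equiv.Perm.ofSubtype σ : Equiv.Perm ℕ) h with hg
  have hgp : proj g = 0 := by
    rw [hg, proj_eq_degree, map_sum]
    apply Finset.sum_eq_zero
    intro σ _
    rw [← proj_eq_degree, proj_permDV, hp]
  have hge : ∀ e, g e = ∑ σ : Equiv.Perm {x // x ∈ S},
      h (e.map (Equiv.Perm.ofSubtype σ : Equiv.Perm ℕ).toEmbedding) := by
    intro e
    rw [hg, Finsupp.finsetSum_apply]
    simp only [permDV_apply]
  have hinv : ∀ (τ : Equiv.Perm {x // x ∈ S}) e,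
      g (e.map (Equiv.Perm.ofSubtype τ : Equiv.Perm ℕ).toEmbedding) = g e := by
    intro τ e
    rw [hge, hge]
    apply Fintype.sum_equiv (Equiv.mulRight τ)
    intro σ
    congr 1
    rw [Finset.map_map]
    congr 1
    ext x
    simp
  have hsupp : g.support ⊆ Finset.powersetCard k S := by
    intro e he
    rw [Finsupp.mem_support_iff, hge] at he
    obtain ⟨σ, -, hσ⟩ := Finset.exists_ne_zero_of_sum_ne_zero he
    have h1 := Finsupp.mem_support_iff.2 hσ
    rw [Finset.mem_powersetCard]
    constructor
    · intro x hx
      have := hS _ h1 (Finset.mem_map_of_mem _ hx)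
      exact (Equiv.Perm.ofSubtype_apply_mem_iff_mem σ x).1 this
    · simpa using hk _ h1
  by_contra hne
  obtain ⟨e₀, he₀⟩ := Finsupp.ne_iff.1 hne
  have he₀' := hsupp (Finsupp.mem_support_iff.2 he₀)
  rw [Finset.mem_powersetCard] at he₀'
  have hsum : proj g = ∑ e ∈ Finset.powersetCard k S, g e := by
    unfold proj
    apply Finset.sum_subset hsupp
    intro e _ he
    simpa using he
  have hconst : ∑ e ∈ Finset.powersetCard k S, g e = (Finset.powersetCard k S).card • g e₀ := by
    apply Finset.sum_eq_card_nsmul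
    intro e he
    rw [Finset.mem_powersetCard] at he
    obtain ⟨τ, hτ⟩ := exists_perm_map S e₀ e he₀'.1 he.1 (by rw [he₀'.2, he.2])
    rw [← hτ, hinv]
  rw [hgp, hconst] at hsum
  rcases smul_eq_zero.1 hsum.symm with h0 | h0
  · rw [Finset.card_eq_zero] at h0
    have : e₀ ∈ Finset.powersetCard k S := Finset.mem_powersetCard.2 he₀'
    rw [h0] at this
    simp at this
  · exact he₀ h0

lemma isHG_add {k d : ℕ} {u v : HG d} (hu : IsHG k u) (hv : IsHG k v) : IsHG k (u + v) := by
  intro e he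
  rcases Finset.mem_union.1 (Finsupp.support_add he) with h | h
  · exact hu e h
  · exact hv e h

lemma lift_closure {k d : ℕ} {I : Set (HG d)} (hI : ∀ u ∈ I, IsHG k u) {q : Fin d → ℤ}
    (hq : q ∈ AddSubmonoid.closure (proj '' I)) :
    ∃ h ∈ AddSubmonoid.closure (Perm I), IsHG k h ∧ proj h = q := by
  induction hq using AddSubmonoid.closure_induction with
  | mem x hx =>
    obtain ⟨u, hu, rfl⟩ := hx
    exact ⟨u, AddSubmonoid.subset_closure ⟨u, hu, 1, (permDV_one u).symm⟩, hI u hu, rfl⟩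
  | zero => exact ⟨0, zero_mem _, by intro e he; simp at he, by simp [proj]⟩
  | add x y _ _ hx hy =>
    obtain ⟨a, ha, ha', rfl⟩ := hx
    obtain ⟨b, hb, hb', rfl⟩ := hy
    exact ⟨a + b, add_mem ha hb, isHG_add ha' hb', by simp [proj_eq_degree]⟩

/-- If the projection of `u ∈ I` is reversible in the projections, then `u` is reversible. -/
lemma reversible_of_proj {k d : ℕ} {I : Set (HG d)} (hI : ∀ u ∈ I, IsHG k u) {u : HG d}
    (hu : u ∈ I) (hq : -proj u ∈ AddSubmonoid.closure (proj '' I)) :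
    -u ∈ NsumDV (Perm I) := by
  obtain ⟨h, hh, hk, hp⟩ := lift_closure hI hq
  have huc : u ∈ AddSubmonoid.closure (Perm I) :=
    AddSubmonoid.subset_closure ⟨u, hu, 1, (permDV_one u).symm⟩
  have hz := avg_zero (u + h) (isHG_add (hI u hu) hk)
    (by rw [proj_eq_degree, map_add, ← proj_eq_degree, ← proj_eq_degree, hp]; simp)
    ((u + h).support.sup id) (fun e he => Finset.le_sup (f := id) he)
  rw [← Finset.add_sum_erase _ _ (Finset.mem_univ 1), map_one, permDV_one] at hz
  apply closure_sub_Nsum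
  have : -u = h + ∑ σ ∈ (Finset.univ : Finset (Equiv.Perm
      {x // x ∈ (u + h).support.sup id})).erase 1,
      permDV (Equiv.Perm.ofSubtype σ : Equiv.Perm ℕ) (u + h) := by
    rw [add_assoc] at hz
    exact neg_eq_of_add_eq_zero_right hz
  rw [this]
  exact add_mem hh (sum_mem fun σ _ => closure_perm _ (add_mem huc hh))

lemma carath {ι V : Type*} [Fintype ι] [AddCommGroup V] [Module ℚ V] (p : ι → V) (q : ι)
    (hq : ∀ l : ι → ℚ, (∀ i, 0 ≤ l i) → ∑ i, l i • p i = 0 → l q = 0) :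
    ∀ (n : ℕ) (x : ι → ℚ), (∀ i, 0 ≤ x i) → {i | x i ≠ 0}.ncard = n →
      ∃ y : ι → ℚ, (∀ i, 0 ≤ y i) ∧ ∑ i, y i • p i = ∑ i, x i • p i ∧ x q ≤ y q ∧
        LinearIndepOn ℚ p {i | y i ≠ 0} := by
  intro n
  induction n using Nat.strong_induction_on with
  | _ n ih =>
  intro x hx hn
  by_cases hli : LinearIndepOn ℚ p {i | x i ≠ 0}
  · exact ⟨x, hx, rfl, le_rfl, hli⟩
  classical
  rw [linearIndepOn_iff''] at hli
  push Not at hli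
  obtain ⟨t, l, ht, hl0, hl, i₀, hi₀, hne⟩ := hli
  have hsum : ∑ i, l i • p i = 0 := by
    rw [← hl]
    symm
    apply Finset.sum_subset (Finset.subset_univ _)
    intro i _ hi
    rw [hl0 i hi, zero_smul]
  have hls : ∀ i, x i = 0 → l i = 0 := fun i hi => hl0 i fun h => ht h hi
  -- choose the sign
  obtain ⟨m, hms, hmx, hmq, j₀, hj₀⟩ : ∃ m : ι → ℚ, ∑ i, m i • p i = 0 ∧
      (∀ i, x i = 0 → m i = 0) ∧ 0 ≤ m q ∧ ∃ j, m j < 0 := by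
    have hnegsum : ∑ i, (-l) i • p i = 0 := by simp [hsum]
    have hnegx : ∀ i, x i = 0 → (-l) i = 0 := fun i hi => by simp [hls i hi]
    rcases lt_trichotomy (l q) 0 with h | h | h
    · refine ⟨-l, hnegsum, hnegx, by simpa using h.le, ?_⟩
      by_contra hcon
      push Not at hcon
      have := hq (-l) hcon hnegsum
      simp at this
      linarith
    · rcases lt_or_gt_of_ne hne with h' | h'
      · exact ⟨l, hsum, hls, h.ge, i₀, h'⟩
      · exact ⟨-l, hnegsum, hnegx, by simp [h], i₀, by simpa using h'⟩
    · refine ⟨l, hsum, hls, h.le, ?_⟩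
      by_contra hcon
      push Not at hcon
      have := hq l hcon hsum
      linarith
  obtain ⟨j, hj, hjmin⟩ := Finset.exists_min_image (Finset.univ.filter fun i => m i < 0)
    (fun i => x i / (-m i)) ⟨j₀, by simpa using hj₀⟩
  simp only [Finset.mem_filter, Finset.mem_univ, true_and] at hj hjmin
  set s := x j / (-m j) with hs
  have hs0 : 0 ≤ s := div_nonneg (hx j) (by linarith)
  have hsj : x j + s * m j = 0 := by
    rw [hs]
    field_simp [hj.ne]
    ring
  have hxj : x j ≠ 0 := fun h => by
    have := hmx j h
    linarith
  obtain ⟨y, hy0, hys, hyq, hyl⟩ := ih _ (by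
      rw [← hn]
      apply Set.ncard_lt_ncard (s := {i | x i + s * m i ≠ 0}) _ (Set.toFinite _)
      refine ⟨fun i hi h => hi ?_, fun hcon => hcon (show j ∈ {i | x i ≠ 0} from hxj) hsj⟩
      rw [h, hmx i h]; simp) (fun i => x i + s * m i) (by
      intro i
      by_cases hi : m i < 0
      · have := hjmin i hi
        rw [le_div_iff₀ (by linarith)] at this
        linarith
      · push Not at hi
        exact add_nonneg (hx i) (mul_nonneg hs0 hi)) rfl
  refine ⟨y, hy0, ?_, ?_, hyl⟩
  · rw [hys]
    simp only [add_smul, mul_smul, Finset.sum_add_distrib, ← Finset.smul_sum, hms]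
    simp
  · have := mul_nonneg hs0 hmq
    linarith

lemma det_abs_le {n : Type*} [Fintype n] [DecidableEq n] (A : Matrix n n ℚ) :
    |A.det| ≤ ∏ j, ∑ r, |A r j| := by
  rw [Matrix.det_apply]
  calc |∑ σ : Equiv.Perm n, Equiv.Perm.sign σ • ∏ i, A (σ i) i|
      ≤ ∑ σ : Equiv.Perm n, |Equiv.Perm.sign σ • ∏ i, A (σ i) i| := Finset.abs_sum_le_sum_abs _ _
    _ = ∑ σ : Equiv.Perm n, ∏ i, |A (σ i) i| := by
        refine Finset.sum_congr rfl fun σ _ => ?_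
        rw [← Finset.abs_prod]
        rcases Int.units_eq_one_or (Equiv.Perm.sign σ) with h | h <;> simp [h]
    _ = ∑ f ∈ (Finset.univ : Finset (Equiv.Perm n)).map
          ⟨fun σ : Equiv.Perm n => (σ : n → n), Equiv.coe_fn_injective⟩, ∏ i, |A (f i) i| := by
        rw [Finset.sum_map]; rfl
    _ ≤ ∑ f : n → n, ∏ i, |A (f i) i| :=
        Finset.sum_le_sum_of_subset_of_nonneg (Finset.subset_univ _)
          fun f _ _ => Finset.prod_nonneg fun i _ => abs_nonneg _
    _ = ∏ j, ∑ r, |A r j| := by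
        rw [Finset.prod_univ_sum, Fintype.piFinset_univ]

lemma cramer_bound {ι : Type*} [Fintype ι] {d : ℕ} (p : ι → Fin d → ℤ) (M : ℕ) (hM : 1 ≤ M)
    (hp : ∀ i, l1 (p i) ≤ M) (c : Fin d → ℤ) (y : ι → ℚ)
    (hy : ∑ i, y i • (fun r => (p i r : ℚ)) = fun r => (c r : ℚ))
    (hli : LinearIndepOn ℚ (fun i => (fun r => (p i r : ℚ) : Fin d → ℚ)) {i | y i ≠ 0}) (q : ι) :
    y q ≤ d * linf c * M ^ (d - 1) := by
  classical
  by_cases hq : y q = 0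
  · rw [hq]; positivity
  let P : ι ⊕ Fin d → Fin d → ℤ := Sum.elim p (fun i => Pi.single i 1)
  let V : ι ⊕ Fin d → Fin d → ℚ := fun z r => (P z r : ℚ)
  have hPM : ∀ z, l1 (P z) ≤ M := by
    rintro (i | i)
    · exact hp i
    · refine le_trans (le_of_eq ?_) hM
      simp only [P, Sum.elim_inr, l1]
      rw [Finset.sum_eq_single i] <;> simp +contextual [Pi.single_apply]
  have hliV : LinearIndepOn ℚ V (Sum.inl '' {i | y i ≠ 0}) := by
    apply LinearIndepOn.image_of_comp
    exact hli
  obtain ⟨b, -, hsb, hspan, hb⟩ := exists_linearIndepOn_extension hliV (Set.subset_univ _)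
  have htop : Submodule.span ℚ (V '' b) = ⊤ := by
    rw [eq_top_iff, ← (Pi.basisFun ℚ (Fin d)).span_eq, Submodule.span_le]
    rintro _ ⟨i, rfl⟩
    apply hspan
    refine ⟨Sum.inr i, trivial, ?_⟩
    funext r
    simp [V, P, Pi.single_apply]
  let B : Module.Basis b ℚ (Fin d → ℚ) := Module.Basis.mk (v := fun z : b => V z) hb (by
    rw [← htop, Set.image_eq_range])
  have hcard : Fintype.card b = d := by
    rw [← Module.finrank_eq_card_basis B]; simp
  let e : Fin d ≃ b := (Fintype.equivFinOfCardEq hcard).symm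
  let A : Matrix (Fin d) (Fin d) ℤ := fun r j => P (e j) r
  let AQ : Matrix (Fin d) (Fin d) ℚ := A.map (fun z : ℤ => (z : ℚ))
  have hdet : AQ.det = (A.det : ℚ) := ((Int.castRingHom ℚ).map_det A).symm
  have hdet0 : AQ.det ≠ 0 := by
    have : LinearIndependent ℚ AQ.col := by
      have := hb.comp e e.injective
      exact this
    rw [Matrix.linearIndependent_cols_iff_isUnit, Matrix.isUnit_iff_isUnit_det] at this
    exact this.ne_zero
  have hdet1 : 1 ≤ |AQ.det| := by
    rw [hdet] at hdet0 ⊢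
    have : A.det ≠ 0 := by exact_mod_cast hdet0
    exact_mod_cast Int.one_le_abs this
  let Y : ι ⊕ Fin d → ℚ := Sum.elim y 0
  have hYb : ∀ z, z ∉ b → Y z = 0 := by
    rintro (i | i) hz
    · by_contra h
      exact hz (hsb ⟨i, h, rfl⟩)
    · rfl
  let yy : Fin d → ℚ := fun j => Y (e j)
  have hmul : AQ.mulVec yy = fun r => (c r : ℚ) := by
    rw [← hy]
    funext r
    have h1 : AQ.mulVec yy r = ∑ z : b, V z r * Y z := by
      rw [Matrix.mulVec, dotProduct]
      exact Fintype.sum_equiv e _ _ (fun j => rfl)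
    have h2 : ∑ z : b, V z r * Y z = ∑ z, V z r * Y z := by
      rw [← Finset.sum_subtype (s := Finset.univ.filter (· ∈ b)) (p := (· ∈ b)) (by simp)
        (f := fun z => V z r * Y z)]
      apply Finset.sum_subset (Finset.subset_univ _)
      intro z _ hz
      rw [hYb z (by simpa using hz), mul_zero]
    rw [h1, h2, Fintype.sum_sum_type]
    simp [Y, V, P, mul_comm]
  let jq : Fin d := e.symm ⟨Sum.inl q, hsb ⟨q, hq, rfl⟩⟩
  have hyq : yy jq = y q := by simp [yy, jq, Y]
  have hcr : AQ.det * y q = (AQ.updateCol jq (fun r => (c r : ℚ))).det := by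
    rw [← Matrix.cramer_apply, Matrix.cramer_eq_adjugate_mulVec, ← hmul, Matrix.mulVec_mulVec,
      Matrix.adjugate_mul, Matrix.smul_mulVec, Matrix.one_mulVec, ← hyq]
    rfl
  have hcs : ∑ r, |(c r : ℚ)| ≤ d * linf c := by
    have : ∀ r ∈ (Finset.univ : Finset (Fin d)), |(c r : ℚ)| ≤ linf c := by
      intro r _
      have h1 : (c r).natAbs ≤ linf c :=
        Finset.le_sup (f := fun i => (c i).natAbs) (Finset.mem_univ r)
      have h2 : |(c r : ℚ)| = ((c r).natAbs : ℚ) := by simp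
      rw [h2]
      exact_mod_cast h1
    simpa using Finset.sum_le_card_nsmul _ _ _ this
  have hb1 : |(AQ.updateCol jq (fun r => (c r : ℚ))).det| ≤ d * linf c * M ^ (d - 1) := by
    refine (det_abs_le _).trans ?_
    rw [← Finset.mul_prod_erase _ _ (Finset.mem_univ jq)]
    apply mul_le_mul
    · simpa using hcs
    · have : ∀ j ∈ Finset.univ.erase jq,
          ∑ r, |(AQ.updateCol jq (fun r => (c r : ℚ))) r j| ≤ M := by
        intro j hj
        have hj' : j ≠ jq := Finset.ne_of_mem_erase hj
        have h1 := hPM (e j)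
        have h2 : ∑ r, |(AQ.updateCol jq (fun r => (c r : ℚ))) r j| = (l1 (P (e j)) : ℚ) := by
          simp [Matrix.updateCol_ne hj', l1, AQ, A, Matrix.map_apply]
          rfl
        rw [h2]
        exact_mod_cast h1
      refine (Finset.prod_le_prod (fun j _ => Finset.sum_nonneg fun r _ => abs_nonneg _) this).trans ?_
      simp [Finset.card_erase_of_mem]
    · exact Finset.prod_nonneg fun j _ => Finset.sum_nonneg fun r _ => abs_nonneg _
    · positivity
  calc y q ≤ |y q| := le_abs_self _
    _ ≤ |AQ.det| * |y q| := le_mul_of_one_le_left (abs_nonneg _) hdet1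
    _ = |(AQ.updateCol jq (fun r => (c r : ℚ))).det| := by rw [← abs_mul, hcr]
    _ ≤ _ := hb1

lemma d_mul_pow (d M : ℕ) : d * M ^ (d - 1) ≤ (M + 1) ^ d := by
  induction d with
  | zero => simp
  | succ n ih =>
    have h1 : M ^ n ≤ (M + 1) ^ n := Nat.pow_le_pow_left (by omega) n
    rcases n with _ | n
    · simp
    · simp only [Nat.add_sub_cancel] at *
      have := Nat.mul_le_mul_right M ih
      have e1 : (n + 1) * M ^ n * M = (n + 1) * M ^ (n + 1) := by ring
      rw [pow_succ (M + 1)]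
      nlinarith

lemma final_arith (d V L m : ℕ) (hm : 1 ≤ m) :
    d * V * (max 1 L) ^ (d - 1) ≤ (L + V + 2) ^ (d + m) := by
  have h1 := d_mul_pow d (max 1 L)
  have h2 : (max 1 L + 1) ^ d ≤ (L + V + 2) ^ d := Nat.pow_le_pow_left (by omega) d
  calc d * V * (max 1 L) ^ (d - 1) = d * (max 1 L) ^ (d - 1) * V := by ring
    _ ≤ (L + V + 2) ^ d * (L + V + 2) := Nat.mul_le_mul (h1.trans h2) (by omega)
    _ = (L + V + 2) ^ (d + 1) := by ring
    _ ≤ _ := Nat.pow_le_pow_right (by omega) (by omega)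

/-- rational nonnegative relation through `q` gives `-q` in the closure -/
lemma neg_mem_of_rat {d : ℕ} (Q : Finset (Fin d → ℤ)) (q : Q) (l : Q → ℚ) (hl : ∀ i, 0 ≤ l i)
    (hs : ∑ i, l i • (fun r => (i.1 r : ℚ)) = (0 : Fin d → ℚ)) (hq : l q ≠ 0) :
    -q.1 ∈ AddSubmonoid.closure (Q : Set (Fin d → ℤ)) := by
  classical
  obtain ⟨D, hD, hn⟩ : ∃ D : ℕ, 0 < D ∧ ∀ i, ∃ n : ℕ, (D : ℚ) * l i = n := by
    refine ⟨∏ i, (l i).den, Finset.prod_pos fun i _ => (l i).den_pos, fun i => ?_⟩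
    refine ⟨(∏ j ∈ Finset.univ.erase i, (l j).den) * (l i).num.toNat, ?_⟩
    rw [← Finset.mul_prod_erase _ _ (Finset.mem_univ i)]
    have h1 : (((l i).num.toNat : ℕ) : ℚ) = (l i).num := by
      have := Int.toNat_of_nonneg (Rat.num_nonneg.2 (hl i))
      exact_mod_cast this
    have h2 : ((l i).den : ℚ) * l i = (l i).num := by
      rw [mul_comm]; exact Rat.mul_den_eq_num _
    push_cast
    rw [h1, ← h2]
    ring
  choose n hn using hn
  have hsum : ∑ i, n i • i.1 = 0 := by
    funext r
    have h1 := congrFun hs r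
    simp only [Finset.sum_apply, Pi.smul_apply, smul_eq_mul, Pi.zero_apply] at h1
    have h2 : ∑ i : Q, (n i : ℚ) * (i.1 r : ℚ) = 0 := by
      simp only [← hn, mul_assoc, ← Finset.mul_sum, h1, mul_zero]
    simp only [Finset.sum_apply, Pi.smul_apply, nsmul_eq_mul, Pi.zero_apply]
    exact_mod_cast h2
  have hnq : n q ≠ 0 := by
    intro h
    have := hn q
    rw [h] at this
    simp [hD.ne', hq] at this
  obtain ⟨m, hm⟩ := Nat.exists_eq_succ_of_ne_zero hnq
  rw [← Finset.add_sum_erase _ _ (Finset.mem_univ q), hm, Nat.succ_eq_add_one, add_smul, one_smul,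
    add_comm (m • q.1), add_assoc] at hsum
  rw [neg_eq_of_add_eq_zero_right hsum]
  exact add_mem (nsmul_mem (AddSubmonoid.subset_closure q.2) _)
    (sum_mem fun i _ => nsmul_mem (AddSubmonoid.subset_closure i.2) _)

lemma proj_mem_of_perm {d : ℕ} {I : Set (HG d)} {w : HG d} (hw : w ∈ Perm I) :
    proj w ∈ proj '' I := by
  obtain ⟨u, hu, π, rfl⟩ := hw
  exact ⟨u, hu, (proj_permDV π u).symm⟩

/-- **Lemma (bound on the use of nonreversible data vectors).**
Let `I` be a finite set of data vectors of arity `k` and dimension `d`,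
partitioned into the set `I₁` of data vectors reversible in `Perm(I)` and the
set `I₂` of data vectors nonreversible in `Perm(I)`.  Suppose a data vector
`v` can be expressed as a finite sum
`v = Σ_{y ∈ Perm(I₁)} a_y·y + Σ_{w ∈ Perm(I₂)} b_w·w` with coefficients in
`ℕ`.  Then
`Σ b_w ≤ |P(I₂)| · (‖P(I)‖_{1,∞} + ‖P(v)‖_∞ + 2)^(d + |I|)`. -/
theorem bound_nonreversible_data
    (k d : ℕ) (hk : 1 ≤ k) (hd : 1 ≤ d)
    (I : Set (HG d)) (hIfin : I.Finite) (hI : ∀ u ∈ I, IsHG k u)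
    (I₁ I₂ : Set (HG d)) (hunion : I₁ ∪ I₂ = I) (hdisj : Disjoint I₁ I₂)
    (hrev : ∀ u ∈ I₁, -u ∈ NsumDV (Perm I))
    (hnonrev : ∀ u ∈ I₂, ¬ (-u ∈ NsumDV (Perm I)))
    (v : HG d)
    (n₁ n₂ : ℕ) (ys : Fin n₁ → HG d) (ws : Fin n₂ → HG d)
    (hys : ∀ i, ys i ∈ Perm I₁) (hws : ∀ j, ws j ∈ Perm I₂)
    (a : Fin n₁ → ℕ) (b : Fin n₂ → ℕ)
    (hsol : v = ∑ i, a i • ys i + ∑ j, b j • ws j) :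
    ∑ j, b j ≤
      (proj '' I₂).ncard *
        ((hIfin.image proj).toFinset.sup l1 + linf (proj v) + 2)
          ^ (d + I.ncard) := by
  classical
  set Q : Finset (Fin d → ℤ) := (hIfin.image proj).toFinset with hQ
  have hQm : ∀ z, z ∈ Q ↔ z ∈ proj '' I := fun z => by simp [hQ]
  have hI₁ : I₁ ⊆ I := hunion ▸ Set.subset_union_left
  have hI₂ : I₂ ⊆ I := hunion ▸ Set.subset_union_right
  have hI₂fin : (proj '' I₂).Finite := (hIfin.subset hI₂).image proj
  have hyQ : ∀ i, proj (ys i) ∈ Q := fun i =>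
    (hQm _).2 (Set.image_mono hI₁ (proj_mem_of_perm (hys i)))
  have hwQ : ∀ j, proj (ws j) ∈ Q := fun j =>
    (hQm _).2 (Set.image_mono hI₂ (proj_mem_of_perm (hws j)))
  have hv : proj v = ∑ i, a i • proj (ys i) + ∑ j, b j • proj (ws j) := by
    simp only [proj_eq_degree, hsol, map_add, map_sum, map_nsmul]
  let X : Q → ℕ := fun z => (∑ i, if proj (ys i) = z.1 then a i else 0) +
    ∑ j, if proj (ws j) = z.1 then b j else 0
  have hX : ∑ z : Q, X z • z.1 = proj v := by
    have key : ∀ (n : ℕ) (c : Fin n → ℕ) (u : Fin n → (Fin d → ℤ)) (hu : ∀ i, u i ∈ Q),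
        ∑ z : Q, (∑ i, if u i = z.1 then c i else 0) • z.1 = ∑ i, c i • u i := by
      intro n c u hu
      simp only [Finset.sum_smul]
      rw [Finset.sum_comm]
      refine Finset.sum_congr rfl fun i _ => ?_
      rw [Finset.sum_eq_single ⟨u i, hu i⟩]
      · simp
      · intro z _ hz
        rw [if_neg, zero_smul]
        exact fun h => hz (Subtype.ext h.symm)
      · simp
    simp only [X, add_smul, Finset.sum_add_distrib]
    rw [key n₁ a (fun i => proj (ys i)) hyQ, key n₂ b (fun j => proj (ws j)) hwQ, hv]
  have hbound : ∀ q ∈ hI₂fin.toFinset, (∑ j, if proj (ws j) = q then b j else 0) ≤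
      (Q.sup l1 + linf (proj v) + 2) ^ (d + I.ncard) := by
    intro q hq
    rw [Set.Finite.mem_toFinset] at hq
    obtain ⟨u, hu, rfl⟩ := hq
    let qq : Q := ⟨proj u, (hQm _).2 ⟨u, hI₂ hu, rfl⟩⟩
    obtain ⟨y, -, hys', hyq, hyl⟩ := carath (fun z : Q => (fun r => (z.1 r : ℚ) : Fin d → ℚ)) qq
      (by
        intro l hl hs
        by_contra hne
        apply hnonrev u hu
        apply reversible_of_proj hI (hI₂ hu)
        have := neg_mem_of_rat Q qq l hl hs hne
        have hc : (Q : Set (Fin d → ℤ)) = proj '' I := by ext z; exact hQm z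
        rwa [hc] at this) _ (fun z => (X z : ℚ)) (fun z => by positivity) rfl
    have hcr := cramer_bound (fun z : Q => z.1) (max 1 (Q.sup l1)) (le_max_left _ _)
      (fun z => (Finset.le_sup (f := l1) z.2).trans (le_max_right _ _)) (proj v) y
      (by
        rw [hys']
        funext r
        rw [← hX]
        simp [Finset.sum_apply]) hyl qq
    have h1 : X qq ≤ d * linf (proj v) * (max 1 (Q.sup l1)) ^ (d - 1) := by
      have := hyq.trans hcr
      exact_mod_cast this
    have hcard : 1 ≤ I.ncard := (Set.ncard_pos hIfin).2 ⟨u, hI₂ hu⟩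
    exact (Nat.le_add_left _ _).trans (h1.trans (final_arith _ _ _ _ hcard))
  calc ∑ j, b j = ∑ q ∈ hI₂fin.toFinset, ∑ j, if proj (ws j) = q then b j else 0 := by
        rw [Finset.sum_comm]
        refine Finset.sum_congr rfl fun j _ => ?_
        rw [Finset.sum_ite_eq, if_pos]
        rw [Set.Finite.mem_toFinset]
        exact proj_mem_of_perm (hws j)
    _ ≤ hI₂fin.toFinset.card • _ := Finset.sum_le_card_nsmul _ _ _ hbound
    _ = _ := by rw [Set.ncard_eq_toFinset_card _ hI₂fin, smul_eq_mul]
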